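/- arXiv:1203.6668 — 7 statements merged into one kernel-verified Lean document; each statement's English description precedes it below -/
import Mathlib

section
/- Let M be an ergodic Markov chain on a finite state space Ω with transition matrix P, reversible with respect to a positive probability distribution π, and let W = {w_x : x ∈ Ω} be any set of canonical closed odd walks (one closed odd walk w_x from x to x for each state x) with congestion η(W). Then the smallest eigenvalue λ_{N−1} of P satisfies (1 + λ_{N−1})^{−1} ≤ η(W)/2; equivalently, λ_{N−1} ≥ −1 + 2/η(W). -/
theorem aux_alt (u : ℕ → ℝ) (n : ℕ) :
    ∑ j ∈ Finset.range n, (-1 : ℝ) ^ j * (u j + u (j + 1)) = u 0 - (-1) ^ n * u n := by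
  induction n with
  | zero => simp
  | succ k ih => rw [Finset.sum_range_succ, ih, pow_succ]; ring

theorem aux_sq (u : ℕ → ℝ) (n : ℕ) (hn : Odd n) (h : u n = u 0) :
    4 * u 0 ^ 2 ≤ n * ∑ j ∈ Finset.range n, (u j + u (j + 1)) ^ 2 := by
  have h1 := aux_alt u n
  rw [hn.neg_one_pow, h] at h1
  have h2 := sq_sum_le_card_mul_sum_sq (s := Finset.range n)
    (f := fun j => (-1 : ℝ) ^ j * (u j + u (j + 1)))
  rw [h1, Finset.card_range] at h2
  have h3 : ∀ j, ((-1 : ℝ) ^ j * (u j + u (j + 1))) ^ 2 = (u j + u (j + 1)) ^ 2 := by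
    intro j
    rw [mul_pow, ← pow_mul, mul_comm j 2, pow_mul]; simp
  simp only [h3] at h2
  linarith

theorem aux_count {Ω : Type*} [Fintype Ω] [DecidableEq Ω] (p : ℕ → Ω) (n : ℕ)
    (f : Ω → Ω → ℝ) :
    ∑ j ∈ Finset.range n, f (p j) (p (j + 1)) =
      ∑ a, ∑ b, (((Finset.range n).filter
            (fun j => p j = a ∧ p (j + 1) = b)).card : ℝ) * f a b := by
  have : ∀ a b, (((Finset.range n).filter
            (fun j => p j = a ∧ p (j + 1) = b)).card : ℝ) * f a b =
      ∑ j ∈ Finset.range n, if p j = a then (if p (j + 1) = b then f a b else 0) else 0 := by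
    intro a b
    rw [Finset.card_filter]
    push_cast
    rw [Finset.sum_mul]
    refine Finset.sum_congr rfl fun j _ => ?_
    by_cases h1 : p j = a <;> by_cases h2 : p (j + 1) = b <;> simp [h1, h2]
  simp only [this]
  symm
  calc _ = ∑ a, ∑ j ∈ Finset.range n, ∑ b,
        (if p j = a then (if p (j + 1) = b then f a b else 0) else 0) :=
        Finset.sum_congr rfl fun a _ => Finset.sum_comm
    _ = ∑ j ∈ Finset.range n, ∑ a, ∑ b,
        (if p j = a then (if p (j + 1) = b then f a b else 0) else 0) := Finset.sum_comm
    _ = _ := by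
      refine Finset.sum_congr rfl fun j _ => ?_
      rw [Finset.sum_eq_single (p j)]
      · simp
      · intro a _ ha
        simp [Ne.symm ha]
      · simp



/-- Diaconis–Saloff-Coste bound on the smallest eigenvalue.
Let `M` be an ergodic (irreducible and aperiodic) Markov chain on a finite state space `Ω`
with transition matrix `P`, reversible with respect to a positive probability distribution `π`,
and let `W = {w x : x ∈ Ω}` be any family of canonical closed odd walks (for each state `x`,
`w x` is a closed walk from `x` to `x` of odd length `ℓ x` in the underlying graph of the
chain), with congestion
`η = max over directed edges (a,b) of Q(a,b)⁻¹ * ∑_x r((a,b), w x) * π x * ℓ x`,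
where `Q(a,b) = π a * P a b` and `r(e, w)` counts occurrences of the directed edge `e` in `w`.
Then the smallest eigenvalue `λ_{N-1}` of `P` satisfies `(1 + λ_{N-1})⁻¹ ≤ η / 2`;
equivalently, every (real) eigenvalue `lam` of `P` satisfies `lam ≥ -1 + 2 / η`. -/
theorem smallest_eigenvalue_bound_congestion
    {Ω : Type*} [Fintype Ω] [Nonempty Ω] [DecidableEq Ω]
    (P : Matrix Ω Ω ℝ) (π : Ω → ℝ)
    -- `P` is a stochastic matrix
    (hP0 : ∀ x y, 0 ≤ P x y)
    (hP1 : ∀ x, ∑ y, P x y = 1)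
    -- `π` is a positive probability distribution
    (hπpos : ∀ x, 0 < π x) (hπ1 : ∑ x, π x = 1)
    -- reversibility
    (hrev : ∀ x y, π x * P x y = π y * P y x)
    -- ergodicity: irreducibility and aperiodicity
    (hirr : ∀ x y : Ω, ∃ k : ℕ, 0 < k ∧ 0 < (P ^ k) x y)
    (haper : ∀ x : Ω, ∃ s : Finset ℕ,
      (∀ k ∈ s, 0 < k ∧ 0 < (P ^ k) x x) ∧ s.gcd id = 1)
    -- the family of canonical closed odd walks: `w x` has length `ℓ x`
    (ℓ : Ω → ℕ) (w : Ω → ℕ → Ω)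
    (hodd : ∀ x, Odd (ℓ x))
    (hstart : ∀ x, w x 0 = x) (hend : ∀ x, w x (ℓ x) = x)
    (hstep : ∀ x, ∀ j < ℓ x, 0 < P (w x j) (w x (j + 1)))
    -- the congestion of the family of walks
    (η : ℝ)
    (hη : η = sSup {v : ℝ | ∃ a b : Ω, 0 < P a b ∧
      v = (π a * P a b)⁻¹ *
        ∑ x : Ω, (((Finset.range (ℓ x)).filter
            (fun j => w x j = a ∧ w x (j + 1) = b)).card : ℝ) * π x * (ℓ x : ℝ)})
    -- `lam` is an eigenvalue of `P`
    (lam : ℝ) (v : Ω → ℝ) (hv : v ≠ 0) (heig : P.mulVec v = lam • v) :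
    -1 + 2 / η ≤ lam := by
  set r : Ω → Ω → Ω → ℝ := fun x a b => (((Finset.range (ℓ x)).filter
            (fun j => w x j = a ∧ w x (j + 1) = b)).card : ℝ) with hr
  have hη0 : 0 ≤ η := by
    rw [hη]
    apply Real.sSup_nonneg
    rintro z ⟨a, b, hab, rfl⟩
    refine mul_nonneg (inv_nonneg.2 (mul_nonneg (hπpos a).le (hP0 a b))) ?_
    exact Finset.sum_nonneg fun x _ =>
      mul_nonneg (mul_nonneg (Nat.cast_nonneg _) (hπpos x).le) (Nat.cast_nonneg _)
  have hC : ∀ a b, ∑ x, r x a b * π x * (ℓ x : ℝ) ≤ η * (π a * P a b) := by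
    intro a b
    rcases (hP0 a b).lt_or_eq with hab | hab
    · have hQ : 0 < π a * P a b := mul_pos (hπpos a) hab
      have : (π a * P a b)⁻¹ * ∑ x, r x a b * π x * (ℓ x : ℝ) ≤ η := by
        rw [hη]
        apply le_csSup
        · apply Set.Finite.bddAbove
          refine (Set.finite_range (fun q : Ω × Ω => (π q.1 * P q.1 q.2)⁻¹ *
            ∑ x, r x q.1 q.2 * π x * (ℓ x : ℝ))).subset ?_
          rintro z ⟨a, b, _, rfl⟩
          exact ⟨(a, b), rfl⟩
        · exact ⟨a, b, hab, rfl⟩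
      rw [inv_mul_le_iff₀ hQ] at this
      linarith
    · rw [← hab, mul_zero, mul_zero]
      apply le_of_eq
      refine Finset.sum_eq_zero fun x _ => ?_
      have : r x a b = 0 := by
        simp only [hr, Nat.cast_eq_zero, Finset.card_eq_zero]
        apply Finset.filter_eq_empty_iff.2
        rintro j hj ⟨h1, h2⟩
        have := hstep x j (Finset.mem_range.1 hj)
        rw [h1, h2, ← hab] at this
        exact lt_irrefl _ this
      rw [this]; ring
  set S : ℝ := ∑ x, π x * v x ^ 2 with hS
  have hSpos : 0 < S := by
    obtain ⟨x, hx⟩ := Function.ne_iff.1 hv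
    have hx' : v x ≠ 0 := hx
    refine Finset.sum_pos' (fun y _ => mul_nonneg (hπpos y).le (sq_nonneg _))
      ⟨x, Finset.mem_univ _, mul_pos (hπpos x) (by positivity)⟩
  have hE : ∑ a, ∑ b, (π a * P a b) * (v a + v b) ^ 2 = 2 * (1 + lam) * S := by
    have e1 : ∑ a, ∑ b, (π a * P a b) * v a ^ 2 = S := by
      refine Finset.sum_congr rfl fun a _ => ?_
      rw [← Finset.sum_mul, ← Finset.mul_sum, hP1, mul_one]
    have e2 : ∑ a, ∑ b, (π a * P a b) * v b ^ 2 = S := by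
      rw [Finset.sum_comm, ← e1]
      refine Finset.sum_congr rfl fun a _ => Finset.sum_congr rfl fun b _ => ?_
      rw [hrev]
    have e3 : ∑ a, ∑ b, (π a * P a b) * (v a * v b) = lam * S := by
      rw [hS, Finset.mul_sum]
      refine Finset.sum_congr rfl fun a _ => ?_
      have h := congrFun heig a
      simp only [Matrix.mulVec, dotProduct, Pi.smul_apply, smul_eq_mul] at h
      calc _ = π a * v a * ∑ b, P a b * v b := by
            rw [Finset.mul_sum]
            exact Finset.sum_congr rfl fun b _ => by ring
        _ = _ := by rw [h]; ring
    calc _ = ∑ a, ∑ b, ((π a * P a b) * v a ^ 2 + (π a * P a b) * v b ^ 2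
          + 2 * ((π a * P a b) * (v a * v b))) :=
          Finset.sum_congr rfl fun a _ => Finset.sum_congr rfl fun b _ => by ring
      _ = _ := by
          simp only [Finset.sum_add_distrib, ← Finset.mul_sum]
          simp only [Finset.mul_sum] at e1 e2 e3 ⊢
          simp only [← Finset.mul_sum] at e1 e2 e3 ⊢
          linarith
  have hmain : 4 * S ≤ η * (2 * (1 + lam) * S) := by
    calc 4 * S = ∑ x, π x * (4 * v x ^ 2) := by
          rw [hS, Finset.mul_sum]
          exact Finset.sum_congr rfl fun x _ => by ring
      _ ≤ ∑ x, π x * ((ℓ x : ℝ) * ∑ a, ∑ b, r x a b * (v a + v b) ^ 2) := by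
          refine Finset.sum_le_sum fun x _ => mul_le_mul_of_nonneg_left ?_ (hπpos x).le
          have h := aux_sq (fun j => v (w x j)) (ℓ x) (hodd x) (by simp [hstart, hend])
          rw [aux_count (w x) (ℓ x) (fun a b => (v a + v b) ^ 2)] at h
          simpa only [hstart] using h
      _ = ∑ a, ∑ b, (∑ x, r x a b * π x * (ℓ x : ℝ)) * (v a + v b) ^ 2 := by
          simp only [Finset.mul_sum, Finset.sum_mul]
          rw [Finset.sum_comm]
          refine Finset.sum_congr rfl fun a _ => ?_
          rw [Finset.sum_comm]
          exact Finset.sum_congr rfl fun b _ => Finset.sum_congr rfl fun x _ => by ring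
      _ ≤ ∑ a, ∑ b, (η * (π a * P a b)) * (v a + v b) ^ 2 :=
          Finset.sum_le_sum fun a _ => Finset.sum_le_sum fun b _ =>
            mul_le_mul_of_nonneg_right (hC a b) (sq_nonneg _)
      _ = η * (2 * (1 + lam) * S) := by
          rw [← hE]
          simp only [Finset.mul_sum, mul_assoc]
  have h2 : 2 ≤ η * (1 + lam) := by
    by_contra hcon
    push Not at hcon
    nlinarith [mul_pos (sub_pos.2 hcon) hSpos]
  have hηpos : 0 < η := by
    rcases hη0.lt_or_eq with h | h
    · exact h
    · rw [← h] at h2; norm_num at h2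
  have : 2 / η ≤ 1 + lam := by
    rw [div_le_iff₀ hηpos]; linarith
  linarith
end

section
/- Let r = (r_1,…,r_m) and c = (c_1,…,c_n) be vectors of positive integers with a common sum, with min{m,n} ≥ 2 and max{m,n} ≥ 3. If X ∈ Ω_{r,c} is bad (neither row-good nor column-good), then m = n and every row and every column of X contains exactly one positive entry. -/
open Finset

/-- `X` is a contingency table with row sums `r` and column sums `c`. -/
def IsContingencyTable {m n : ℕ} (r : Fin m → ℕ) (c : Fin n → ℕ)
    (X : Matrix (Fin m) (Fin n) ℕ) : Prop :=
  (∀ i, ∑ j, X i j = r i) ∧ (∀ j, ∑ i, X i j = c j)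

/-- `X` is row-good: there are distinct rows `i₁, i₂, i₃` and distinct columns `j₁, j₂`
with `X i₁ j₁`, `X i₂ j₁`, `X i₃ j₂` all positive. -/
def RowGood {m n : ℕ} (X : Matrix (Fin m) (Fin n) ℕ) : Prop :=
  ∃ (i₁ i₂ i₃ : Fin m) (j₁ j₂ : Fin n),
    i₁ ≠ i₂ ∧ i₁ ≠ i₃ ∧ i₂ ≠ i₃ ∧ j₁ ≠ j₂ ∧
    0 < X i₁ j₁ ∧ 0 < X i₂ j₁ ∧ 0 < X i₃ j₂

/-- `X` is column-good: there are distinct rows `i₁, i₂` and distinct columns `j₁, j₂, j₃`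
with `X i₁ j₁`, `X i₁ j₂`, `X i₂ j₃` all positive. -/
def ColGood {m n : ℕ} (X : Matrix (Fin m) (Fin n) ℕ) : Prop :=
  ∃ (i₁ i₂ : Fin m) (j₁ j₂ j₃ : Fin n),
    i₁ ≠ i₂ ∧ j₁ ≠ j₂ ∧ j₁ ≠ j₃ ∧ j₂ ≠ j₃ ∧
    0 < X i₁ j₁ ∧ 0 < X i₁ j₂ ∧ 0 < X i₂ j₃

theorem exists_third {k : ℕ} (h : 3 ≤ k) (a b : Fin k) : ∃ d, d ≠ a ∧ d ≠ b := by
  by_contra hcon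
  push Not at hcon
  have h1 : (Finset.univ : Finset (Fin k)) ⊆ {a, b} := by
    intro x _
    by_cases hx : x = a
    · simp [hx]
    · simp [hcon x hx]
  have h2 := Finset.card_le_card h1
  have h3 := Finset.card_le_two (a := a) (b := b)
  simp at h2
  omega

theorem exists_second {k : ℕ} (h : 2 ≤ k) (a : Fin k) : ∃ d, d ≠ a := by
  haveI : Nontrivial (Fin k) := Fin.nontrivial_iff_two_le.mpr h
  exact exists_ne a

theorem col_unique {m n : ℕ} (P : Fin m → Fin n → Prop)
    (hR : ∀ i, ∃ j, P i j) (hC : ∀ j, ∃ i, P i j)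
    (hn : 2 ≤ n) (hmax : 3 ≤ m ∨ 3 ≤ n)
    (h1 : ∀ i₁ i₂ i₃ j₁ j₂, i₁ ≠ i₂ → i₁ ≠ i₃ → i₂ ≠ i₃ → j₁ ≠ j₂ →
      P i₁ j₁ → P i₂ j₁ → P i₃ j₂ → False)
    (h2 : ∀ i₁ i₂ j₁ j₂ j₃, i₁ ≠ i₂ → j₁ ≠ j₂ → j₁ ≠ j₃ → j₂ ≠ j₃ →
      P i₁ j₁ → P i₁ j₂ → P i₂ j₃ → False)
    (a b : Fin m) (j : Fin n) (ha : P a j) (hb : P b j) : a = b := by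
  by_contra hab
  have key : ∀ j', j' ≠ j → P a j' ∨ P b j' := by
    intro j' hj
    obtain ⟨i, hi⟩ := hC j'
    by_cases hia : i = a
    · left; rwa [← hia]
    by_cases hib : i = b
    · right; rwa [← hib]
    exact (h1 a b i j j' hab (Ne.symm hia) (Ne.symm hib) hj.symm ha hb hi).elim
  obtain ⟨k, hk⟩ := exists_second hn j
  rcases hmax with h | h
  · obtain ⟨d, hda, hdb⟩ := exists_third h a b
    have hd : P d j := by
      obtain ⟨l, hl⟩ := hR d
      by_cases hlj : l = j
      · rwa [← hlj]
      exact (h1 a b d j l hab hda.symm hdb.symm (Ne.symm hlj) ha hb hl).elim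
    rcases key k hk with h | h
    · exact h1 b d a j k hdb.symm (Ne.symm hab) hda hk.symm hb hd h
    · exact h1 a d b j k hda.symm hab hdb hk.symm ha hd h
  · obtain ⟨l, hlj, hlk⟩ := exists_third h j k
    rcases key k hk with h | h <;> rcases key l hlj with h' | h'
    · exact h2 a b k l j hab hlk.symm hk hlj h h' hb
    · exact h2 a b j k l hab hk.symm hlj.symm hlk.symm ha h h'
    · exact h2 b a j k l (Ne.symm hab) hk.symm hlj.symm hlk.symm hb h h'
    · exact h2 b a k l j (Ne.symm hab) hlk.symm hk hlj h h' ha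

/-- Let `r` and `c` be vectors of positive integers with a common sum,
with `min{m,n} ≥ 2` and `max{m,n} ≥ 3`.  If `X ∈ Ω_{r,c}` is bad (neither row-good nor
column-good), then `m = n` and every row and every column of `X` contains exactly one
positive entry. -/
theorem bad_table_structure {m n : ℕ} (r : Fin m → ℕ) (c : Fin n → ℕ)
    (hr : ∀ i, 0 < r i) (hc : ∀ j, 0 < c j)
    (hsum : ∑ i, r i = ∑ j, c j)
    (hm : 2 ≤ m) (hn : 2 ≤ n) (hmax : 3 ≤ max m n)
    (X : Matrix (Fin m) (Fin n) ℕ) (hX : IsContingencyTable r c X)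
    (hbad : ¬ RowGood X ∧ ¬ ColGood X) :
    m = n ∧
    (∀ i : Fin m, (Finset.univ.filter (fun j : Fin n => 0 < X i j)).card = 1) ∧
    (∀ j : Fin n, (Finset.univ.filter (fun i : Fin m => 0 < X i j)).card = 1) := by
  obtain ⟨hb1, hb2⟩ := hbad
  have hR : ∀ i, ∃ j, 0 < X i j := by
    intro i
    by_contra hcon
    push Not at hcon
    have h := hr i
    rw [← hX.1 i, Finset.sum_eq_zero (fun j _ => Nat.le_zero.mp (hcon j))] at h
    exact lt_irrefl _ h
  have hC : ∀ j, ∃ i, 0 < X i j := by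
    intro j
    by_contra hcon
    push Not at hcon
    have h := hc j
    rw [← hX.2 j, Finset.sum_eq_zero (fun i _ => Nat.le_zero.mp (hcon i))] at h
    exact lt_irrefl _ h
  have hmx : 3 ≤ m ∨ 3 ≤ n := le_max_iff.mp hmax
  have hcu := col_unique (fun i j => 0 < X i j) hR hC hn hmx
    (fun i₁ i₂ i₃ j₁ j₂ a b c d e f g => hb1 ⟨i₁, i₂, i₃, j₁, j₂, a, b, c, d, e, f, g⟩)
    (fun i₁ i₂ j₁ j₂ j₃ a b c d e f g => hb2 ⟨i₁, i₂, j₁, j₂, j₃, a, b, c, d, e, f, g⟩)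
  have hru := col_unique (fun j i => 0 < X i j) hC hR hm hmx.symm
    (fun j₁ j₂ j₃ i₁ i₂ a b c d e f g => hb2 ⟨i₁, i₂, j₁, j₂, j₃, d, a, b, c, e, f, g⟩)
    (fun j₁ j₂ i₁ i₂ i₃ a b c d e f g => hb1 ⟨i₁, i₂, i₃, j₁, j₂, b, c, d, a, e, f, g⟩)
  refine ⟨?_, ?_, ?_⟩
  · choose f hf using hR
    choose g hg using hC
    have h1 : Function.Injective f := fun x y hxy =>
      hcu x y (f x) (hf x) (by simpa only [hxy] using hf y)
    have h2 : Function.Injective g := fun x y hxy =>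
      hru x y (g x) (hg x) (by simpa only [hxy] using hg y)
    have h3 := Fintype.card_le_of_injective f h1
    have h4 := Fintype.card_le_of_injective g h2
    simp only [Fintype.card_fin] at h3 h4
    omega
  · intro i
    obtain ⟨j, hj⟩ := hR i
    rw [Finset.card_eq_one]
    refine ⟨j, Finset.ext fun x => ?_⟩
    simp only [Finset.mem_filter, Finset.mem_univ, true_and, Finset.mem_singleton]
    exact ⟨fun hx => hru x j i hx hj, fun hx => hx ▸ hj⟩
  · intro j
    obtain ⟨i, hi⟩ := hC j
    rw [Finset.card_eq_one]
    refine ⟨i, Finset.ext fun x => ?_⟩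
    simp only [Finset.mem_filter, Finset.mem_univ, true_and, Finset.mem_singleton]
    exact ⟨fun hx => hcu x i j hx hi, fun hx => hx ▸ hi⟩
end

section
/- Let r = (r_1,…,r_m) and c = (c_1,…,c_n) be vectors of positive integers with a common sum satisfying r_1 ≥ r_2 ≥ ⋯ ≥ r_m and c_1 ≥ c_2 ≥ ⋯ ≥ c_n, with min{m,n} ≥ 2, max{m,n} ≥ 3 and min{r_1, c_1} ≥ 2. If X ∈ Ω_{r,c} is bad (neither row-good nor column-good), then there exist distinct i_1,i_2,i_3 ∈ {1,…,m} and distinct j_1,j_2,j_3 ∈ {1,…,n} such that x_{i_1,j_1} ≥ 2 and x_{i_2,j_2} ≥ 1 and x_{i_3,j_3} ≥ 1. -/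
open Finset

theorem bt_third {m : ℕ} (hm : 3 ≤ m) (a b : Fin m) : ∃ k, k ≠ a ∧ k ≠ b := by
  have : ∃ k, k ∉ ({a, b} : Finset (Fin m)) := by
    by_contra h
    push Not at h
    have h1 : (Finset.univ : Finset (Fin m)) ⊆ {a, b} := fun k _ => h k
    have h2 := Finset.card_le_card h1
    have h3 := Finset.card_le_two (a := a) (b := b)
    simp at h2
    omega
  obtain ⟨k, hk⟩ := this
  simp at hk
  exact ⟨k, hk.1, hk.2⟩

theorem bt_second {m : ℕ} (hm : 2 ≤ m) (a : Fin m) : ∃ k, k ≠ a := by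
  haveI : Nontrivial (Fin m) := Fin.nontrivial_iff_two_le.mpr hm
  exact exists_ne a

theorem bt_col {m n : ℕ} (hm : 2 ≤ m) (hn : 2 ≤ n) (hmax : 3 ≤ max m n)
    (X : Matrix (Fin m) (Fin n) ℕ) (h1 : ¬ RowGood X) (h2 : ¬ ColGood X)
    (g : Fin n → Fin m) (hg : ∀ j, 0 < X (g j) j) (f : Fin m → Fin n)
    (hf : ∀ i, 0 < X i (f i)) (a b : Fin m) (j : Fin n)
    (ha : 0 < X a j) (hb : 0 < X b j) : a = b := by
  by_contra hab
  have R : ∀ (i₁ i₂ i₃ : Fin m) (j₁ j₂ : Fin n), i₁ ≠ i₂ → i₁ ≠ i₃ → i₂ ≠ i₃ → j₁ ≠ j₂ →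
      0 < X i₁ j₁ → 0 < X i₂ j₁ → 0 < X i₃ j₂ → False :=
    fun i₁ i₂ i₃ j₁ j₂ p q r s t u v => h1 ⟨i₁, i₂, i₃, j₁, j₂, p, q, r, s, t, u, v⟩
  have C : ∀ (i₁ i₂ : Fin m) (j₁ j₂ j₃ : Fin n), i₁ ≠ i₂ → j₁ ≠ j₂ → j₁ ≠ j₃ → j₂ ≠ j₃ →
      0 < X i₁ j₁ → 0 < X i₁ j₂ → 0 < X i₂ j₃ → False :=
    fun i₁ i₂ j₁ j₂ j₃ p q r s t u v => h2 ⟨i₁, i₂, j₁, j₂, j₃, p, q, r, s, t, u, v⟩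
  by_cases h3 : 3 ≤ m
  · obtain ⟨k, hka, hkb⟩ := bt_third h3 a b
    obtain ⟨l, hl⟩ := bt_second hn j
    have hk : 0 < X k j := by
      by_contra hk
      refine R a b k j (f k) hab hka.symm hkb.symm ?_ ha hb (hf k)
      intro e
      rw [e] at hk
      exact hk (hf k)
    by_cases e1 : g l = a
    · exact R b k (g l) j l hkb.symm (by rw [e1]; exact Ne.symm hab) (by rw [e1]; exact hka)
        hl.symm hb hk (hg l)
    · by_cases e2 : g l = b
      · exact R a k (g l) j l hka.symm (by rw [e2]; exact hab) (by rw [e2]; exact hkb)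
          hl.symm ha hk (hg l)
      · exact R a b (g l) j l hab (Ne.symm e1) (Ne.symm e2) hl.symm ha hb (hg l)
  · have h4 : 3 ≤ n := by
      rcases le_max_iff.mp hmax with h | h
      · exact absurd h h3
      · exact h
    have hm2 : m = 2 := by omega
    obtain ⟨k, hk, -⟩ := bt_third h4 j j
    obtain ⟨l, hl, hlk⟩ := bt_third h4 j k
    have two : ∀ i : Fin m, i = a ∨ i = b := by
      intro i
      have := i.2; have := a.2; have := b.2
      have : (a : ℕ) ≠ b := fun e => hab (Fin.ext e)
      rcases (by omega : (i : ℕ) = a ∨ (i : ℕ) = b) with e | e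
      · exact Or.inl (Fin.ext e)
      · exact Or.inr (Fin.ext e)
    have pk := hg k
    have pl := hg l
    rcases two (g k) with e1 | e1 <;> rcases two (g l) with e2 | e2 <;>
      rw [e1] at pk <;> rw [e2] at pl
    · exact C a b k l j hab hlk.symm hk hl pk pl hb
    · exact C a b j k l hab hk.symm hl.symm hlk.symm ha pk pl
    · exact C b a j k l (Ne.symm hab) hk.symm hl.symm hlk.symm hb pk pl
    · exact C b a k l j (Ne.symm hab) hlk.symm hk hl pk pl ha

/-- Let `r` and `c` be vectors of positive integers with a common sum,
sorted in nonincreasing order, with `min{m,n} ≥ 2`, `max{m,n} ≥ 3` and `min{r₁,c₁} ≥ 2`.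
If `X ∈ Ω_{r,c}` is bad (neither row-good nor column-good), then there exist distinct rows
`i₁, i₂, i₃` and distinct columns `j₁, j₂, j₃` such that `X i₁ j₁ ≥ 2`, `X i₂ j₂ ≥ 1`
and `X i₃ j₃ ≥ 1`. -/
theorem bad_table_has_canonical_tuple {m n : ℕ} (r : Fin m → ℕ) (c : Fin n → ℕ)
    (hr : ∀ i, 0 < r i) (hc : ∀ j, 0 < c j)
    (hsum : ∑ i, r i = ∑ j, c j)
    (hrmono : Antitone r) (hcmono : Antitone c)
    (hm : 2 ≤ m) (hn : 2 ≤ n) (hmax : 3 ≤ max m n)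
    (hr1 : 2 ≤ r ⟨0, by omega⟩) (hc1 : 2 ≤ c ⟨0, by omega⟩)
    (X : Matrix (Fin m) (Fin n) ℕ) (hX : IsContingencyTable r c X)
    (hbad : ¬ RowGood X ∧ ¬ ColGood X) :
    ∃ (i₁ i₂ i₃ : Fin m) (j₁ j₂ j₃ : Fin n),
      i₁ ≠ i₂ ∧ i₁ ≠ i₃ ∧ i₂ ≠ i₃ ∧ j₁ ≠ j₂ ∧ j₁ ≠ j₃ ∧ j₂ ≠ j₃ ∧
      2 ≤ X i₁ j₁ ∧ 1 ≤ X i₂ j₂ ∧ 1 ≤ X i₃ j₃ := by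
  obtain ⟨hXr, hXc⟩ := hX
  obtain ⟨h1, h2⟩ := hbad
  have hf : ∀ i, ∃ j, 0 < X i j := by
    intro i
    have := hr i
    rw [← hXr i] at this
    by_contra hh
    push Not at hh
    rw [Finset.sum_eq_zero (fun j _ => Nat.le_zero.mp (hh j))] at this
    exact lt_irrefl _ this
  have hg : ∀ j, ∃ i, 0 < X i j := by
    intro j
    have := hc j
    rw [← hXc j] at this
    by_contra hh
    push Not at hh
    rw [Finset.sum_eq_zero (fun i _ => Nat.le_zero.mp (hh i))] at this
    exact lt_irrefl _ this
  choose f hf using hf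
  choose g hg using hg
  have colU := bt_col hm hn hmax X h1 h2 g hg f hf
  have rowU : ∀ (a b : Fin n) (i : Fin m), 0 < X i a → 0 < X i b → a = b := by
    refine bt_col hn hm (by rwa [max_comm]) X.transpose ?_ ?_ f hf g hg
    · rintro ⟨i₁, i₂, i₃, j₁, j₂, p, q, r, s, t, u, v⟩
      exact h2 ⟨j₁, j₂, i₁, i₂, i₃, s, p, q, r, t, u, v⟩
    · rintro ⟨i₁, i₂, j₁, j₂, j₃, p, q, r, s, t, u, v⟩
      exact h1 ⟨j₁, j₂, j₃, i₁, i₂, q, r, s, p, t, u, v⟩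
  rcases le_max_iff.mp hmax with h3 | h3
  · set z : Fin m := ⟨0, by omega⟩ with hz
    obtain ⟨k, hk, -⟩ := bt_third h3 z z
    obtain ⟨l, hl, hlk⟩ := bt_third h3 z k
    have inj : ∀ a b, a ≠ b → f a ≠ f b := fun a b hab e =>
      hab (colU a b (f a) (hf a) (by rw [e]; exact hf b))
    refine ⟨z, k, l, f z, f k, f l, hk.symm, hl.symm, hlk.symm, inj _ _ hk.symm,
      inj _ _ hl.symm, inj _ _ hlk.symm, ?_, hf k, hf l⟩
    rw [← hXr z, Finset.sum_eq_single (f z)] at hr1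
    · exact hr1
    · intro b _ hb
      by_contra h0
      exact hb (rowU _ _ z (Nat.pos_of_ne_zero h0) (hf z))
    · simp
  · set z : Fin n := ⟨0, by omega⟩ with hz
    obtain ⟨k, hk, -⟩ := bt_third h3 z z
    obtain ⟨l, hl, hlk⟩ := bt_third h3 z k
    have inj : ∀ a b, a ≠ b → g a ≠ g b := fun a b hab e =>
      hab (rowU a b (g a) (hg a) (by rw [e]; exact hg b))
    refine ⟨g z, g k, g l, z, k, l, inj _ _ hk.symm,
      inj _ _ hl.symm, inj _ _ hlk.symm, hk.symm, hl.symm, hlk.symm, ?_, hg k, hg l⟩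
    rw [← hXc z, Finset.sum_eq_single (g z)] at hc1
    · exact hc1
    · intro b _ hb
      by_contra h0
      exact hb (colU _ _ z (Nat.pos_of_ne_zero h0) (hg z))
    · simp
end

section
/- Let X ∈ Ω_{r,c} and let (i_1,i_2,i_3,j_1,j_2) be row-good for X. Then the matrices A(X) and B(X) both lie in Ω_{r,c} (all entries are nonnegative and all row and column sums are preserved), and each of the three pairs (X, A(X)), (A(X), B(X)), (B(X), X) differ only in a 2×2 subsquare (two rows and two columns), so that X → A(X) → B(X) → X is a closed odd walk of length 3 in the transition graph of the contingency chain. -/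
open Finset

/-- `X` is a contingency table (over `ℤ`, with nonnegativity required explicitly)
with row sums `r` and column sums `c`. -/
def IsContingencyTableZ {m n : ℕ} (r : Fin m → ℕ) (c : Fin n → ℕ)
    (X : Matrix (Fin m) (Fin n) ℤ) : Prop :=
  (∀ i j, 0 ≤ X i j) ∧ (∀ i, ∑ j, X i j = (r i : ℤ)) ∧ (∀ j, ∑ i, X i j = (c j : ℤ))

/-- `U` and `V` differ only in a 2×2 subsquare: there are two distinct rows and two
distinct columns such that `U` and `V` agree at every entry outside those rows and
columns. -/
def DifferIn2x2 {m n : ℕ} (U V : Matrix (Fin m) (Fin n) ℤ) : Prop :=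
  ∃ (a a' : Fin m) (b b' : Fin n), a ≠ a' ∧ b ≠ b' ∧
    ∀ k l, ((k ≠ a ∧ k ≠ a') ∨ (l ≠ b ∧ l ≠ b')) → U k l = V k l

/-- The first matrix `A(X)` of the canonical walk for a row-good 5-tuple
`(i₁,i₂,i₃,j₁,j₂)`: subtract 1 from entries `(i₁,j₁)` and `(i₃,j₂)` and add 1 to
entries `(i₁,j₂)` and `(i₃,j₁)`. -/
def rowGoodA {m n : ℕ} (X : Matrix (Fin m) (Fin n) ℤ)
    (i₁ i₃ : Fin m) (j₁ j₂ : Fin n) : Matrix (Fin m) (Fin n) ℤ :=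
  fun k l =>
    if k = i₁ ∧ l = j₁ then X k l - 1
    else if k = i₁ ∧ l = j₂ then X k l + 1
    else if k = i₃ ∧ l = j₁ then X k l + 1
    else if k = i₃ ∧ l = j₂ then X k l - 1
    else X k l

/-- The second matrix `B(X)` of the canonical walk for a row-good 5-tuple
`(i₁,i₂,i₃,j₁,j₂)`: subtract 1 from entries `(i₂,j₁)` and `(i₃,j₂)` and add 1 to
entries `(i₂,j₂)` and `(i₃,j₁)`. -/
def rowGoodB {m n : ℕ} (X : Matrix (Fin m) (Fin n) ℤ)
    (i₂ i₃ : Fin m) (j₁ j₂ : Fin n) : Matrix (Fin m) (Fin n) ℤ :=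
  fun k l =>
    if k = i₂ ∧ l = j₁ then X k l - 1
    else if k = i₂ ∧ l = j₂ then X k l + 1
    else if k = i₃ ∧ l = j₁ then X k l + 1
    else if k = i₃ ∧ l = j₂ then X k l - 1
    else X k l

theorem aux_isCT {m n : ℕ} (r : Fin m → ℕ) (c : Fin n → ℕ)
    (X : Matrix (Fin m) (Fin n) ℤ) (hX : IsContingencyTableZ r c X)
    (i i' : Fin m) (j j' : Fin n) (hi : i ≠ i') (hj : j ≠ j')
    (h1 : 0 < X i j) (h3 : 0 < X i' j') :
    IsContingencyTableZ r c (rowGoodA X i i' j j') := by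
  obtain ⟨h0, hR, hC⟩ := hX
  have key : ∀ k l, rowGoodA X i i' j j' k l = X k l +
      ((if k = i then (-1 : ℤ) else 0) + (if k = i' then 1 else 0)) *
      ((if l = j then (1 : ℤ) else 0) + (if l = j' then -1 else 0)) := by
    intro k l
    unfold rowGoodA
    by_cases a : k = i <;> by_cases b : k = i' <;> by_cases d : l = j <;>
      by_cases e : l = j' <;> simp_all <;> ring
  refine ⟨?_, ?_, ?_⟩
  · intro k l
    have := h0 k l
    unfold rowGoodA
    split_ifs with a b d e
    · obtain ⟨rfl, rfl⟩ := a; omega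
    · omega
    · omega
    · obtain ⟨rfl, rfl⟩ := e; omega
    · omega
  · intro k
    simp only [key, Finset.sum_add_distrib, ← Finset.mul_sum, hR]
    simp
  · intro l
    simp only [key, Finset.sum_add_distrib, ← Finset.sum_mul, hC]
    simp

/-- Let `X ∈ Ω_{r,c}` and let `(i₁,i₂,i₃,j₁,j₂)` be row-good for `X`.
Then the matrices `A(X)` and `B(X)` both lie in `Ω_{r,c}` (all entries nonnegative and all
row and column sums preserved), and each of the three pairs `(X, A(X))`, `(A(X), B(X))`,
`(B(X), X)` differ only in a 2×2 subsquare, so that `X → A(X) → B(X) → X` is a closed odd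
walk of length 3 in the transition graph of the contingency chain. -/
theorem row_good_walk {m n : ℕ} (r : Fin m → ℕ) (c : Fin n → ℕ)
    (hr : ∀ i, 0 < r i) (hc : ∀ j, 0 < c j)
    (hsum : ∑ i, r i = ∑ j, c j)
    (X : Matrix (Fin m) (Fin n) ℤ) (hX : IsContingencyTableZ r c X)
    (i₁ i₂ i₃ : Fin m) (j₁ j₂ : Fin n)
    (hi12 : i₁ ≠ i₂) (hi13 : i₁ ≠ i₃) (hi23 : i₂ ≠ i₃) (hj : j₁ ≠ j₂)
    (h1 : 0 < X i₁ j₁) (h2 : 0 < X i₂ j₁) (h3 : 0 < X i₃ j₂) :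
    IsContingencyTableZ r c (rowGoodA X i₁ i₃ j₁ j₂) ∧
    IsContingencyTableZ r c (rowGoodB X i₂ i₃ j₁ j₂) ∧
    DifferIn2x2 X (rowGoodA X i₁ i₃ j₁ j₂) ∧
    DifferIn2x2 (rowGoodA X i₁ i₃ j₁ j₂) (rowGoodB X i₂ i₃ j₁ j₂) ∧
    DifferIn2x2 (rowGoodB X i₂ i₃ j₁ j₂) X := by
  refine ⟨aux_isCT r c X hX i₁ i₃ j₁ j₂ hi13 hj h1 h3,
    aux_isCT r c X hX i₂ i₃ j₁ j₂ hi23 hj h2 h3,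
    ⟨i₁, i₃, j₁, j₂, hi13, hj, ?_⟩, ⟨i₁, i₂, j₁, j₂, hi12, hj, ?_⟩,
    ⟨i₂, i₃, j₁, j₂, hi23, hj, ?_⟩⟩
  · intro k l h
    unfold rowGoodA
    grind
  · intro k l h
    unfold rowGoodA rowGoodB
    grind
  · intro k l h
    unfold rowGoodB
    grind
end

section
/- Let X ∈ Ω_{r,c}, let i_1,i_2,i_3 ∈ {1,…,m} be distinct and j_1,j_2,j_3 ∈ {1,…,n} be distinct, and suppose x_{i_k,j_ℓ} = 0 for all k ≠ ℓ (k,ℓ ∈ {1,2,3}), x_{i_1,j_1} ≥ 2, x_{i_2,j_2} ≥ 1 and x_{i_3,j_3} ≥ 1. Then the matrices X_1, X_2, X_3, X_4 all lie in Ω_{r,c} (all entries nonnegative with all row and column sums preserved), and each consecutive pair among (X, X_1), (X_1, X_2), (X_2, X_3), (X_3, X_4), (X_4, X) differ only in a 2×2 subsquare (two rows and two columns), so that X → X_1 → X_2 → X_3 → X_4 → X is a closed odd walk of length 5 in the transition graph of the contingency chain. -/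
open Finset

/-- The matrix agreeing with `X` outside rows `i₁,i₂,i₃` and columns `j₁,j₂,j₃` whose
3×3 subsquare on those rows and columns is given (row by row) by the nine values
`y₁₁, y₁₂, y₁₃, y₂₁, y₂₂, y₂₃, y₃₁, y₃₂, y₃₃`. -/
def subsquare3 {m n : ℕ} (X : Matrix (Fin m) (Fin n) ℤ)
    (i₁ i₂ i₃ : Fin m) (j₁ j₂ j₃ : Fin n)
    (y₁₁ y₁₂ y₁₃ y₂₁ y₂₂ y₂₃ y₃₁ y₃₂ y₃₃ : ℤ) : Matrix (Fin m) (Fin n) ℤ :=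
  fun k l =>
    if k = i₁ ∧ l = j₁ then y₁₁
    else if k = i₁ ∧ l = j₂ then y₁₂
    else if k = i₁ ∧ l = j₃ then y₁₃
    else if k = i₂ ∧ l = j₁ then y₂₁
    else if k = i₂ ∧ l = j₂ then y₂₂
    else if k = i₂ ∧ l = j₃ then y₂₃
    else if k = i₃ ∧ l = j₁ then y₃₁
    else if k = i₃ ∧ l = j₂ then y₃₂
    else if k = i₃ ∧ l = j₃ then y₃₃
    else X k l

theorem sum_three_aux {ι : Type*} [Fintype ι] [DecidableEq ι] (f g : ι → ℤ) (a b c : ι)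
    (hab : a ≠ b) (hac : a ≠ c) (hbc : b ≠ c)
    (h : ∀ i, i ≠ a → i ≠ b → i ≠ c → g i = f i)
    (hs : g a + g b + g c = f a + f b + f c) : ∑ i, g i = ∑ i, f i := by
  have key : ∀ i, g i = f i + ((if i = a then g a - f a else 0) +
      (if i = b then g b - f b else 0) + (if i = c then g c - f c else 0)) := by
    intro i
    by_cases h1 : i = a
    · subst h1; simp [hab, hac]
    by_cases h2 : i = b
    · subst h2; simp [h1, hbc]
    by_cases h3 : i = c
    · subst h3; simp [h1, h2]
    simp [h1, h2, h3, h i h1 h2 h3]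
  rw [Finset.sum_congr rfl (fun i _ => key i)]
  simp only [Finset.sum_add_distrib, Finset.sum_ite_eq', Finset.sum_ite_eq, Finset.mem_univ, if_true]
  linarith

theorem subsquare3_aux {m n : ℕ} (r : Fin m → ℕ) (c : Fin n → ℕ)
    (X : Matrix (Fin m) (Fin n) ℤ) (hX : IsContingencyTableZ r c X)
    (i₁ i₂ i₃ : Fin m) (j₁ j₂ j₃ : Fin n)
    (hi12 : i₁ ≠ i₂) (hi13 : i₁ ≠ i₃) (hi23 : i₂ ≠ i₃)
    (hj12 : j₁ ≠ j₂) (hj13 : j₁ ≠ j₃) (hj23 : j₂ ≠ j₃)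
    (a b d e f g p q s : ℤ)
    (ha : 0 ≤ a) (hb : 0 ≤ b) (hd : 0 ≤ d) (he : 0 ≤ e) (hf : 0 ≤ f) (hg : 0 ≤ g)
    (hp : 0 ≤ p) (hq : 0 ≤ q) (hs : 0 ≤ s)
    (r1 : a + b + d = X i₁ j₁ + X i₁ j₂ + X i₁ j₃)
    (r2 : e + f + g = X i₂ j₁ + X i₂ j₂ + X i₂ j₃)
    (r3 : p + q + s = X i₃ j₁ + X i₃ j₂ + X i₃ j₃)
    (c1 : a + e + p = X i₁ j₁ + X i₂ j₁ + X i₃ j₁)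
    (c2 : b + f + q = X i₁ j₂ + X i₂ j₂ + X i₃ j₂)
    (c3 : d + g + s = X i₁ j₃ + X i₂ j₃ + X i₃ j₃) :
    IsContingencyTableZ r c (subsquare3 X i₁ i₂ i₃ j₁ j₂ j₃ a b d e f g p q s) := by
  obtain ⟨h0, hr, hc⟩ := hX
  refine ⟨?_, ?_, ?_⟩
  · intro k l
    unfold subsquare3
    have := h0 k l
    split_ifs <;> assumption
  · intro k
    rw [← hr k]
    apply sum_three_aux _ _ j₁ j₂ j₃ hj12 hj13 hj23
    · intro l h1 h2 h3
      simp [subsquare3, h1, h2, h3]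
    · by_cases h1 : k = i₁
      · subst h1; simpa [subsquare3, hj12.symm, hj13.symm, hj23.symm] using r1
      by_cases h2 : k = i₂
      · subst h2; simpa [subsquare3, h1, hj12.symm, hj13.symm, hj23.symm] using r2
      by_cases h3 : k = i₃
      · subst h3; simpa [subsquare3, h1, h2, hj12.symm, hj13.symm, hj23.symm] using r3
      simp [subsquare3, h1, h2, h3]
  · intro l
    rw [← hc l]
    apply sum_three_aux _ _ i₁ i₂ i₃ hi12 hi13 hi23
    · intro k h1 h2 h3
      simp [subsquare3, h1, h2, h3]
    · by_cases h1 : l = j₁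
      · subst h1
        simpa [subsquare3, hi12.symm, hi13.symm, hi23.symm] using c1
      by_cases h2 : l = j₂
      · subst h2
        simpa [subsquare3, h1, hi12.symm, hi13.symm, hi23.symm] using c2
      by_cases h3 : l = j₃
      · subst h3
        simpa [subsquare3, h1, h2, hi12.symm, hi13.symm, hi23.symm] using c3
      simp [subsquare3, h1, h2, h3]

/-- Let `X ∈ Ω_{r,c}`, let `i₁,i₂,i₃` be distinct rows and `j₁,j₂,j₃` be
distinct columns, and suppose `X iₖ jₗ = 0` for all `k ≠ ℓ` (`k,ℓ ∈ {1,2,3}`),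
`X i₁ j₁ ≥ 2`, `X i₂ j₂ ≥ 1` and `X i₃ j₃ ≥ 1`.  Then, writing `y k ℓ = X iₖ jₗ`,
the matrices
`X₁ = (y₁₁−1, 1, 0; 1, y₂₂−1, 0; 0, 0, y₃₃)`,
`X₂ = (y₁₁−1, 1, 0; 0, y₂₂−1, 1; 1, 0, y₃₃−1)`,
`X₃ = (y₁₁−2, 1, 1; 1, y₂₂−1, 0; 1, 0, y₃₃−1)`,
`X₄ = (y₁₁−1, 0, 1; 0, y₂₂, 0; 1, 0, y₃₃−1)`
(on the 3×3 subsquare, agreeing with `X` elsewhere) all lie in `Ω_{r,c}`, and each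
consecutive pair among `(X,X₁), (X₁,X₂), (X₂,X₃), (X₃,X₄), (X₄,X)` differ only in a 2×2
subsquare, so that `X → X₁ → X₂ → X₃ → X₄ → X` is a closed odd walk of length 5 in the
transition graph of the contingency chain. -/
theorem bad_table_walk {m n : ℕ} (r : Fin m → ℕ) (c : Fin n → ℕ)
    (hr : ∀ i, 0 < r i) (hc : ∀ j, 0 < c j)
    (hsum : ∑ i, r i = ∑ j, c j)
    (X : Matrix (Fin m) (Fin n) ℤ) (hX : IsContingencyTableZ r c X)
    (i₁ i₂ i₃ : Fin m) (j₁ j₂ j₃ : Fin n)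
    (hi12 : i₁ ≠ i₂) (hi13 : i₁ ≠ i₃) (hi23 : i₂ ≠ i₃)
    (hj12 : j₁ ≠ j₂) (hj13 : j₁ ≠ j₃) (hj23 : j₂ ≠ j₃)
    (hz12 : X i₁ j₂ = 0) (hz13 : X i₁ j₃ = 0) (hz21 : X i₂ j₁ = 0)
    (hz23 : X i₂ j₃ = 0) (hz31 : X i₃ j₁ = 0) (hz32 : X i₃ j₂ = 0)
    (h11 : 2 ≤ X i₁ j₁) (h22 : 1 ≤ X i₂ j₂) (h33 : 1 ≤ X i₃ j₃) :
    let y₁₁ := X i₁ j₁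
    let y₂₂ := X i₂ j₂
    let y₃₃ := X i₃ j₃
    let X₁ := subsquare3 X i₁ i₂ i₃ j₁ j₂ j₃ (y₁₁ - 1) 1 0 1 (y₂₂ - 1) 0 0 0 y₃₃
    let X₂ := subsquare3 X i₁ i₂ i₃ j₁ j₂ j₃ (y₁₁ - 1) 1 0 0 (y₂₂ - 1) 1 1 0 (y₃₃ - 1)
    let X₃ := subsquare3 X i₁ i₂ i₃ j₁ j₂ j₃ (y₁₁ - 2) 1 1 1 (y₂₂ - 1) 0 1 0 (y₃₃ - 1)
    let X₄ := subsquare3 X i₁ i₂ i₃ j₁ j₂ j₃ (y₁₁ - 1) 0 1 0 y₂₂ 0 1 0 (y₃₃ - 1)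
    IsContingencyTableZ r c X₁ ∧ IsContingencyTableZ r c X₂ ∧
    IsContingencyTableZ r c X₃ ∧ IsContingencyTableZ r c X₄ ∧
    DifferIn2x2 X X₁ ∧ DifferIn2x2 X₁ X₂ ∧ DifferIn2x2 X₂ X₃ ∧
    DifferIn2x2 X₃ X₄ ∧ DifferIn2x2 X₄ X := by
  intro y₁₁ y₂₂ y₃₃ X₁ X₂ X₃ X₄
  have key := subsquare3_aux r c X hX i₁ i₂ i₃ j₁ j₂ j₃ hi12 hi13 hi23 hj12 hj13 hj23
  refine ⟨?_, ?_, ?_, ?_, ⟨i₁, i₂, j₁, j₂, hi12, hj12, ?_⟩, ⟨i₂, i₃, j₁, j₃, hi23, hj13, ?_⟩,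
    ⟨i₁, i₂, j₁, j₃, hi12, hj13, ?_⟩, ⟨i₁, i₂, j₁, j₂, hi12, hj12, ?_⟩,
    ⟨i₁, i₃, j₁, j₃, hi13, hj13, ?_⟩⟩
  iterate 4 (apply key <;> omega)
  all_goals
    intro k l h
    simp only [X₁, X₂, X₃, X₄, y₁₁, y₂₂, y₃₃, subsquare3]
    grind
end

section
/- Let M be an ergodic (irreducible and aperiodic) Markov chain on a finite state space Ω with transition matrix P, reversible with respect to a positive probability distribution π. Then for every state x ∈ Ω there exists a closed odd walk w from x to x in the underlying graph of M such that every directed edge occurs at most twice in w and every self-loop edge occurs at most once in w. -/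
theorem walk_of_pow_pos {Ω : Type*} [Fintype Ω] [DecidableEq Ω]
    (P : Matrix Ω Ω ℝ) (hP0 : ∀ x y, 0 ≤ P x y) (k : ℕ) :
    ∀ x y : Ω, 0 < (P ^ k) x y →
      ∃ w : ℕ → Ω, w 0 = x ∧ w k = y ∧ ∀ j < k, 0 < P (w j) (w (j + 1)) := by
  induction k with
  | zero =>
    intro x y h
    rw [pow_zero, Matrix.one_apply] at h
    split_ifs at h with hxy
    · exact ⟨fun _ => x, rfl, hxy, fun j hj => by omega⟩
    · exact absurd h (lt_irrefl _)
  | succ k ih =>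
    intro x y h
    rw [pow_succ', Matrix.mul_apply] at h
    obtain ⟨z, -, hz⟩ := Finset.exists_lt_of_sum_lt (s := Finset.univ) (f := fun _ : Ω => (0:ℝ))
      (g := fun z => P x z * (P ^ k) z y) (by simpa using h)
    have h1 : 0 < P x z := by
      rcases (hP0 x z).lt_or_eq with h1 | h1
      · exact h1
      · simp [← h1] at hz
    have h2 : 0 < (P ^ k) z y := pos_of_mul_pos_right hz h1.le
    obtain ⟨w, hw0, hwk, hw⟩ := ih z y h2
    refine ⟨fun n => Nat.casesOn n x w, rfl, hwk, ?_⟩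
    intro j hj
    cases j with
    | zero => simpa [hw0] using h1
    | succ j => exact hw j (by omega)

/-- Let `M` be an ergodic (irreducible and aperiodic) Markov chain on a finite
state space `Ω` with transition matrix `P`, reversible with respect to a positive probability
distribution `π`.  Then for every state `x ∈ Ω` there exists a closed odd walk `w` from `x`
to `x` in the underlying graph of `M` such that every directed edge `(a,b)` occurs at most
twice in `w`, and every self-loop edge `(a,a)` occurs at most once in `w`. -/
theorem exists_closed_odd_walk_low_multiplicity
    {Ω : Type*} [Fintype Ω] [Nonempty Ω] [DecidableEq Ω]
    (P : Matrix Ω Ω ℝ) (π : Ω → ℝ)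
    -- `P` is a stochastic matrix
    (hP0 : ∀ x y, 0 ≤ P x y)
    (hP1 : ∀ x, ∑ y, P x y = 1)
    -- `π` is a positive probability distribution
    (hπpos : ∀ x, 0 < π x) (hπ1 : ∑ x, π x = 1)
    -- reversibility
    (hrev : ∀ x y, π x * P x y = π y * P y x)
    -- ergodicity: irreducibility and aperiodicity
    (hirr : ∀ x y : Ω, ∃ k : ℕ, 0 < k ∧ 0 < (P ^ k) x y)
    (haper : ∀ x : Ω, ∃ s : Finset ℕ,
      (∀ k ∈ s, 0 < k ∧ 0 < (P ^ k) x x) ∧ s.gcd id = 1)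
    (x : Ω) :
    ∃ (ℓ : ℕ) (w : ℕ → Ω), Odd ℓ ∧ w 0 = x ∧ w ℓ = x ∧
      (∀ j < ℓ, 0 < P (w j) (w (j + 1))) ∧
      ∀ a b : Ω,
        ((Finset.range ℓ).filter (fun j => w j = a ∧ w (j + 1) = b)).card ≤ 2 ∧
        (a = b →
          ((Finset.range ℓ).filter (fun j => w j = a ∧ w (j + 1) = b)).card ≤ 1) := by
  classical
  have hex : ∃ ℓ : ℕ, Odd ℓ ∧ ∃ w : ℕ → Ω, w 0 = x ∧ w ℓ = x ∧
      ∀ j < ℓ, 0 < P (w j) (w (j + 1)) := by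
    obtain ⟨s, hs, hg⟩ := haper x
    by_contra hcon
    have h2 : (2 : ℕ) ∣ s.gcd id := by
      refine Finset.dvd_gcd fun k hk => ?_
      by_contra hk2
      have hodd : Odd k := by
        rw [← Nat.not_even_iff_odd, even_iff_two_dvd]
        exact hk2
      exact hcon ⟨k, hodd, walk_of_pow_pos P hP0 k x x (hs k hk).2⟩
    rw [hg] at h2
    omega
  obtain ⟨hodd, w, hw0, hwl, hw⟩ := Nat.find_spec hex
  have hmin := fun m => @Nat.find_min _ _ hex m
  generalize Nat.find hex = ℓ at *
  have key : ∀ i j, i < j → j ≤ ℓ → w i = w j → i % 2 ≠ j % 2 := by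
    intro i j hij hj hwij hpar
    refine hmin (ℓ - (j - i)) (by omega) ⟨?_, fun n => if n ≤ i then w n else w (n + (j - i)),
      ?_, ?_, ?_⟩
    · rw [Nat.odd_iff] at hodd ⊢
      omega
    · simp [hw0]
    · by_cases h : ℓ - (j - i) ≤ i
      · have e : j = ℓ := by omega
        have e2 : ℓ - (j - i) = i := by omega
        simp only [e2, le_refl, if_true]
        rw [hwij, e, hwl]
      · have e : ℓ - (j - i) + (j - i) = ℓ := by omega
        simp only [if_neg h, e, hwl]
    · intro n hn
      rcases lt_trichotomy n i with h | h | h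
      · simp only [if_pos h.le, if_pos (show n + 1 ≤ i from h)]
        exact hw n (by omega)
      · subst h
        have e : n + 1 + (j - n) = j + 1 := by omega
        simp only [le_refl, if_true, if_neg (show ¬ n + 1 ≤ n by omega), e, hwij]
        exact hw j (by omega)
      · have e : n + 1 + (j - i) = n + (j - i) + 1 := by omega
        simp only [if_neg (show ¬ n ≤ i by omega), if_neg (show ¬ n + 1 ≤ i by omega), e]
        exact hw _ (by omega)
  have key2 : ∀ i j, i ≤ ℓ → j ≤ ℓ → i ≠ j → w i = w j → i % 2 ≠ j % 2 := by
    intro i j hi hj hij h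
    rcases lt_or_gt_of_ne hij with h1 | h1
    · exact key i j h1 hj h
    · exact (key j i h1 hi h.symm).symm
  refine ⟨ℓ, w, hodd, hw0, hwl, hw, fun a b => ⟨?_, ?_⟩⟩
  · by_contra hc
    obtain ⟨i, j, k, hi, hj, hk, hij, hik, hjk⟩ := Finset.two_lt_card_iff.1 (not_le.1 hc)
    simp only [Finset.mem_filter, Finset.mem_range] at hi hj hk
    have h1 := key2 i j (by omega) (by omega) hij (hi.2.1.trans hj.2.1.symm)
    have h2 := key2 i k (by omega) (by omega) hik (hi.2.1.trans hk.2.1.symm)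
    have h3 := key2 j k (by omega) (by omega) hjk (hj.2.1.trans hk.2.1.symm)
    omega
  · rintro rfl
    by_contra hc
    obtain ⟨i, j, hi, hj, hij⟩ := Finset.one_lt_card_iff.1 (not_le.1 hc)
    simp only [Finset.mem_filter, Finset.mem_range] at hi hj
    have h1 := key2 i j (by omega) (by omega) hij (hi.2.1.trans hj.2.1.symm)
    by_cases h : i + 1 = j
    · have := key2 i (j + 1) (by omega) (by omega) (by omega) (hi.2.1.trans hj.2.2.symm)
      omega
    · have := key2 (i + 1) j (by omega) (by omega) h (hi.2.2.trans hj.2.1.symm)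
      omega
end

section
/- Let Z, Z' ∈ Ω_{r,c} with Z ≠ Z' differing only in the 2×2 subsquare on rows i,i' and columns j,j' (a transition e = (Z,Z') of the contingency chain). Then the number of column-good tables X ∈ Ω_{r,c} such that (Z,Z') occurs as a consecutive pair of the canonical walk w_X is at most 12(n−2). -/
open Finset

/-- The 5-tuple `(i₁,i₂,j₁,j₂,j₃)` is column-good for `X`: the rows `i₁,i₂` are distinct,
the columns `j₁,j₂,j₃` are distinct, and `X i₁ j₁`, `X i₁ j₂`, `X i₂ j₃` are all
positive. -/
def ColGoodTuple {m n : ℕ} (X : Matrix (Fin m) (Fin n) ℕ)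
    (t : Fin m × Fin m × Fin n × Fin n × Fin n) : Prop :=
  t.1 ≠ t.2.1 ∧ t.2.2.1 ≠ t.2.2.2.1 ∧ t.2.2.1 ≠ t.2.2.2.2 ∧ t.2.2.2.1 ≠ t.2.2.2.2 ∧
  0 < X t.1 t.2.2.1 ∧ 0 < X t.1 t.2.2.2.1 ∧ 0 < X t.2.1 t.2.2.2.2

/-- The 5-tuples ordered lexicographically. -/
def lex5c {m n : ℕ} (t : Fin m × Fin m × Fin n × Fin n × Fin n) :
    Lex (Fin m × Lex (Fin m × Lex (Fin n × Lex (Fin n × Fin n)))) :=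
  toLex (t.1, toLex (t.2.1, toLex (t.2.2.1, toLex (t.2.2.2.1, t.2.2.2.2))))

/-- The first matrix `A(X)` of the canonical walk for the column-good 5-tuple
`(i₁,i₂,j₁,j₂,j₃)`: subtract 1 from entries `(i₁,j₁)` and `(i₂,j₃)` and add 1 to
entries `(i₂,j₁)` and `(i₁,j₃)`. -/
def colGoodA {m n : ℕ} (X : Matrix (Fin m) (Fin n) ℕ)
    (t : Fin m × Fin m × Fin n × Fin n × Fin n) : Matrix (Fin m) (Fin n) ℕ :=
  fun k l =>
    if k = t.1 ∧ l = t.2.2.1 then X k l - 1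
    else if k = t.2.1 ∧ l = t.2.2.1 then X k l + 1
    else if k = t.1 ∧ l = t.2.2.2.2 then X k l + 1
    else if k = t.2.1 ∧ l = t.2.2.2.2 then X k l - 1
    else X k l

/-- The second matrix `B(X)` of the canonical walk for the column-good 5-tuple
`(i₁,i₂,j₁,j₂,j₃)`: subtract 1 from entries `(i₁,j₂)` and `(i₂,j₃)` and add 1 to
entries `(i₂,j₂)` and `(i₁,j₃)`. -/
def colGoodB {m n : ℕ} (X : Matrix (Fin m) (Fin n) ℕ)
    (t : Fin m × Fin m × Fin n × Fin n × Fin n) : Matrix (Fin m) (Fin n) ℕ :=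
  fun k l =>
    if k = t.1 ∧ l = t.2.2.2.1 then X k l - 1
    else if k = t.2.1 ∧ l = t.2.2.2.1 then X k l + 1
    else if k = t.1 ∧ l = t.2.2.2.2 then X k l + 1
    else if k = t.2.1 ∧ l = t.2.2.2.2 then X k l - 1
    else X k l

/-- Inverse of `X ↦ colGoodA X t`. -/
def colInvA {m n : ℕ} (Z : Matrix (Fin m) (Fin n) ℕ)
    (p : (Fin m × Fin m) × Fin n × Fin n) : Matrix (Fin m) (Fin n) ℕ :=
  fun k l =>
    if k = p.1.1 ∧ l = p.2.1 then Z k l + 1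
    else if k = p.1.2 ∧ l = p.2.1 then Z k l - 1
    else if k = p.1.1 ∧ l = p.2.2 then Z k l - 1
    else if k = p.1.2 ∧ l = p.2.2 then Z k l + 1
    else Z k l

lemma colInvA_colGoodA {m n : ℕ} (X : Matrix (Fin m) (Fin n) ℕ)
    (t : Fin m × Fin m × Fin n × Fin n × Fin n) (h : ColGoodTuple X t) :
    colInvA (colGoodA X t) ((t.1, t.2.1), t.2.2.1, t.2.2.2.2) = X := by
  obtain ⟨i1, i2, j1, j2, j3⟩ := t
  obtain ⟨h1, h2, h3, h4, h5, h6, h7⟩ := h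
  simp only at h1 h2 h3 h4 h5 h6 h7
  funext k l
  simp only [colInvA, colGoodA]
  split_ifs <;> first | rfl | (simp_all; done) | (simp_all; omega)

/-- Let `Z, Z' ∈ Ω_{r,c}` with `Z ≠ Z'` differ only in the 2×2 subsquare
on rows `i,i'` and columns `j,j'` (a transition `e = (Z,Z')` of the contingency chain).
Then the number of column-good tables `X ∈ Ω_{r,c}` such that `(Z,Z')` occurs as a
consecutive pair of the canonical walk `w_X = (X, A(X), B(X), X)` — built from the
lexicographically least column-good 5-tuple for `X` — is at most `12(n-2)`. -/
theorem col_good_walk_congestion {m n : ℕ} (r : Fin m → ℕ) (c : Fin n → ℕ)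
    (hr : ∀ i, 0 < r i) (hc : ∀ j, 0 < c j)
    (hsum : ∑ i, r i = ∑ j, c j)
    (Z Z' : Matrix (Fin m) (Fin n) ℕ)
    (hZ : IsContingencyTable r c Z) (hZ' : IsContingencyTable r c Z')
    (hne : Z ≠ Z')
    (i i' : Fin m) (j j' : Fin n) (hii : i ≠ i') (hjj : j ≠ j')
    (hagree : ∀ k l, ((k ≠ i ∧ k ≠ i') ∨ (l ≠ j ∧ l ≠ j')) → Z k l = Z' k l) :
    {X : Matrix (Fin m) (Fin n) ℕ | IsContingencyTable r c X ∧
      ∃ t, ColGoodTuple X t ∧ (∀ t', ColGoodTuple X t' → lex5c t ≤ lex5c t') ∧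
        ((Z = X ∧ Z' = colGoodA X t) ∨ (Z = colGoodA X t ∧ Z' = colGoodB X t) ∨
          (Z = colGoodB X t ∧ Z' = X))}.ncard ≤ 12 * (n - 2) := by
  classical
  set S := {X : Matrix (Fin m) (Fin n) ℕ | IsContingencyTable r c X ∧
      ∃ t, ColGoodTuple X t ∧ (∀ t', ColGoodTuple X t' → lex5c t ≤ lex5c t') ∧
        ((Z = X ∧ Z' = colGoodA X t) ∨ (Z = colGoodA X t ∧ Z' = colGoodB X t) ∨
          (Z = colGoodB X t ∧ Z' = X))} with hS
  rcases S.eq_empty_or_nonempty with h0 | ⟨X0, h0⟩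
  · rw [h0]; simp
  have hn : 3 ≤ n := by
    obtain ⟨-, ⟨i1, i2, j1, j2, j3⟩, ⟨-, h2, h3, h4, -⟩, -⟩ := h0
    simp only at h2 h3 h4
    have a1 := j1.2
    have a2 := j2.2
    have a3 := j3.2
    rw [Ne, Fin.ext_iff] at h2 h3 h4
    omega
  let P : Finset ((Fin m × Fin m) × Fin n × Fin n) :=
    ({(i, i'), (i', i)} : Finset (Fin m × Fin m)) ×ˢ
      (({j, j'} : Finset (Fin n)) ×ˢ (Finset.univ \ ({j, j'} : Finset (Fin n))))
  let T : Finset (Matrix (Fin m) (Fin n) ℕ) := {Z, Z'} ∪ P.image (colInvA Z)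
  have hsub : S ⊆ (T : Set (Matrix (Fin m) (Fin n) ℕ)) := by
    rintro X ⟨-, t, ht, -, hcase⟩
    rw [Finset.mem_coe, Finset.mem_union]
    rcases hcase with ⟨h, -⟩ | ⟨hA, hB⟩ | ⟨-, h⟩
    · left; simp [h]
    · right
      rw [Finset.mem_image]
      refine ⟨((t.1, t.2.1), t.2.2.1, t.2.2.2.2), ?_, by rw [hA]; exact colInvA_colGoodA X t ht⟩
      obtain ⟨i1, i2, j1, j2, j3⟩ := t
      obtain ⟨h1, h2, h3, h4, h5, h6, h7⟩ := ht
      simp only at h1 h2 h3 h4 h5 h6 h7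
      have key : ∀ k l, Z k l ≠ Z' k l → (k = i ∨ k = i') ∧ (l = j ∨ l = j') := by
        intro k l hkl
        by_contra hcon
        exact hkl (hagree k l (by tauto))
      have e1 := key i1 j1 (by
        rw [hA, hB]; simp [colGoodA, colGoodB, h1, h2, h3]; omega)
      have e2 := key i2 j1 (by
        rw [hA, hB]; simp [colGoodA, colGoodB, h1, h1.symm, h2, h3])
      have e3 := key i1 j2 (by
        rw [hA, hB]; simp [colGoodA, colGoodB, h1, h2.symm, h4]; omega)
      simp only [P, Finset.mem_product, Finset.mem_insert, Finset.mem_singleton,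
        Finset.mem_sdiff, Finset.mem_univ, true_and, Prod.mk.injEq]
      obtain ⟨e1a, e1b⟩ := e1
      obtain ⟨e2a, -⟩ := e2
      obtain ⟨-, e3b⟩ := e3
      refine ⟨?_, e1b, ?_⟩
      · grind
      · grind
    · left; simp [h]
  have hcard : T.card ≤ 2 + 2 * (2 * (n - 2)) := by
    refine (Finset.card_union_le _ _).trans (Nat.add_le_add Finset.card_le_two ?_)
    refine Finset.card_image_le.trans ?_
    rw [Finset.card_product, Finset.card_product, Finset.card_sdiff_of_subset (Finset.subset_univ _),
      Finset.card_pair hjj, Finset.card_univ, Fintype.card_fin]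
    exact Nat.mul_le_mul_right _ Finset.card_le_two
  calc S.ncard ≤ (T : Set (Matrix (Fin m) (Fin n) ℕ)).ncard :=
        Set.ncard_le_ncard hsub T.finite_toSet
    _ = T.card := Set.ncard_coe_finset T
    _ ≤ 12 * (n - 2) := by omega
end
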